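/- Let σ ≥ 2 and 1 ≤ w ≤ k−1. Then (w+1)(w+2)·(Dev_σ(k,w+1) − Dev_σ(k,w)) = −w·Prim_σ(w+1) + Σ_{p=1}^{w} Prim_σ(p)·σ^{w−p}·((w−2p+2)·σ − w + 2p). -/

import Mathlib

open Finset

/-- The `i`-th length-`k` substring (`k`-mer) of a word of length `w + k`
over the alphabet `Fin σ`. -/
def kmerAt (σ k w : ℕ) (v : Fin (w + k) → Fin σ) (i : Fin (w + 1)) : Fin k → Fin σ :=
  fun j => v ⟨i.1 + j.1, by have h1 := i.2; have h2 := j.2; omega⟩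

/-- `v` is a gamechanger with respect to the linear order (ranking) `ρ` on `k`-mers:
either its `k`-prefix is a `ρ`-minimal `k`-mer of `v`, or its `k`-suffix is a
`ρ`-minimal `k`-mer of `v` occurring exactly once in `v`. -/
def IsGC (σ k w : ℕ) (ρ : (Fin k → Fin σ) ≃ Fin (σ ^ k)) (v : Fin (w + k) → Fin σ) : Prop :=
  (∀ i : Fin (w + 1), ρ (kmerAt σ k w v 0) ≤ ρ (kmerAt σ k w v i)) ∨
  ((∀ i : Fin (w + 1), ρ (kmerAt σ k w v (Fin.last w)) ≤ ρ (kmerAt σ k w v i)) ∧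
    (∀ i : Fin (w + 1), kmerAt σ k w v i = kmerAt σ k w v (Fin.last w) → i = Fin.last w))

/-- `P_{σ,k}(v)`: the fraction of linear orders `ρ` on `σ`-ary `k`-strings for which
`v` is a gamechanger. -/
noncomputable def Pgc (σ k w : ℕ) (v : Fin (w + k) → Fin σ) : ℝ :=
  (Nat.card {ρ : (Fin k → Fin σ) ≃ Fin (σ ^ k) // IsGC σ k w ρ v} : ℝ) /
    (Nat.card ((Fin k → Fin σ) ≃ Fin (σ ^ k)) : ℝ)

/-- `D_ρ`: the fraction of gamechangers among all `σ`-ary strings of length `w + k`. -/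
noncomputable def Dens (σ k w : ℕ) (ρ : (Fin k → Fin σ) ≃ Fin (σ ^ k)) : ℝ :=
  (Nat.card {v : Fin (w + k) → Fin σ // IsGC σ k w ρ v} : ℝ) / ((σ : ℝ) ^ (w + k))

/-- `DR_σ(k,w)`: the expected density, i.e. the average of `D_ρ` over all orders `ρ`. -/
noncomputable def DR (σ k w : ℕ) : ℝ :=
  (∑ ρ : (Fin k → Fin σ) ≃ Fin (σ ^ k), Dens σ k w ρ) /
    (Nat.card ((Fin k → Fin σ) ≃ Fin (σ ^ k)) : ℝ)

/-- `DFR_σ(k,w) = (w+1) · DR_σ(k,w)`, the expected density factor. -/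
noncomputable def DFR (σ k w : ℕ) : ℝ := ((w : ℝ) + 1) * DR σ k w

/-- The number of distinct `k`-mers of `v`. -/
def numKmers (σ k w : ℕ) (v : Fin (w + k) → Fin σ) : ℕ :=
  (Finset.univ.image (kmerAt σ k w v)).card

/-- `Rep_{σ,k,w}`: the set of `σ`-ary strings of length `w + k` that contain two equal
`k`-substrings at distinct positions. -/
def RepSet (σ k w : ℕ) : Finset (Fin (w + k) → Fin σ) :=
  Finset.univ.filter fun v =>
    ∃ i j : Fin (w + 1), i ≠ j ∧ kmerAt σ k w v i = kmerAt σ k w v j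

/-- `Dev_σ(k,w)`, the deviation of the random order. -/
noncomputable def Dev (σ k w : ℕ) : ℝ :=
  (∑ v ∈ RepSet σ k w, Pgc σ k w v) - (2 / ((w : ℝ) + 1)) * ((RepSet σ k w).card : ℝ)

/-- `p` is a period of the string `s` (of length `n`): `s[i] = s[i+p]` whenever both
positions are inside `s`. -/
def HasPeriod (σ n : ℕ) (s : Fin n → Fin σ) (p : ℕ) : Prop :=
  ∀ (i : ℕ) (h : i + p < n), s ⟨i, by omega⟩ = s ⟨i + p, h⟩

/-- A string is primitive if it is not of the form `u^m` with `m ≥ 2`, equivalently it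
has no period that is a proper divisor of its length. -/
def IsPrimitive (σ n : ℕ) (s : Fin n → Fin σ) : Prop :=
  ¬ ∃ d, d ∣ n ∧ d < n ∧ HasPeriod σ n s d

/-- `Prim_σ(n)`: the number of primitive `σ`-ary strings of length `n`. -/
noncomputable def Prim (σ n : ℕ) : ℕ :=
  Nat.card {s : Fin n → Fin σ // IsPrimitive σ n s}

/-- The substring of `v` of length `ℓ` starting at (0-indexed) position `i`. -/
def subAt (σ n : ℕ) (v : Fin n → Fin σ) (i ℓ : ℕ) (h : i + ℓ ≤ n) : Fin ℓ → Fin σ :=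
  fun j => v ⟨i + j.1, by have := j.2; omega⟩

/-- A string is `p`-periodic if `p` is its minimal period and `p ≤ |s|/2`. -/
def IsPPeriodic (σ n : ℕ) (s : Fin n → Fin σ) (p : ℕ) : Prop :=
  1 ≤ p ∧ 2 * p ≤ n ∧ HasPeriod σ n s p ∧ ∀ q, 1 ≤ q → q < p → ¬ HasPeriod σ n s q

/-- The occurrence `v[i..i+ℓ)` is a run of period `p`: it is `p`-periodic and is not
contained in a longer `p`-periodic substring of `v`. -/
def IsRun (σ n : ℕ) (v : Fin n → Fin σ) (i ℓ p : ℕ) (h : i + ℓ ≤ n) : Prop :=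
  IsPPeriodic σ ℓ (subAt σ n v i ℓ h) p ∧
    ∀ (i' ℓ' : ℕ) (h' : i' + ℓ' ≤ n), i' ≤ i → i + ℓ ≤ i' + ℓ' → ℓ < ℓ' →
      ¬ IsPPeriodic σ ℓ' (subAt σ n v i' ℓ' h') p

/-- A major run: a run `x` of period `p` with `|x| ≥ |v|/2 + p`. -/
def IsMajorRun (σ n : ℕ) (v : Fin n → Fin σ) (i ℓ p : ℕ) (h : i + ℓ ≤ n) : Prop :=
  IsRun σ n v i ℓ p h ∧ n + 2 * p ≤ 2 * ℓ

/-- total extension of a word -/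
def Wt (σ n : ℕ) (v : Fin n → Fin σ) (x : ℕ) : ℕ := if h : x < n then (v ⟨x, h⟩).1 else 0

/-- the last kmer is not unique -/
def NU (σ k w : ℕ) (v : Fin (w + k) → Fin σ) : Prop :=
  ∃ i : Fin (w + 1), i ≠ Fin.last w ∧ kmerAt σ k w v i = kmerAt σ k w v (Fin.last w)

/-- membership in RepSet -/
def RP (σ k w : ℕ) (v : Fin (w + k) → Fin σ) : Prop :=
  ∃ i j : Fin (w + 1), i ≠ j ∧ kmerAt σ k w v i = kmerAt σ k w v j

def ext1 (σ k w : ℕ) (v : Fin (w + k) → Fin σ) (c : Fin σ) : Fin (w + 1 + k) → Fin σ :=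
  fun x => if h : x.1 < w + k then v ⟨x.1, h⟩ else c

def pre1 (σ k w : ℕ) (c : Fin σ) (v : Fin (w + k) → Fin σ) : Fin (w + 1 + k) → Fin σ :=
  fun x => if h : x.1 = 0 then c else v ⟨x.1 - 1, by have := x.2; omega⟩

lemma kmer_eq_iff (σ k w : ℕ) (v : Fin (w + k) → Fin σ) (i j : Fin (w + 1)) :
    kmerAt σ k w v i = kmerAt σ k w v j ↔
      ∀ t, t < k → Wt σ (w + k) v (i.1 + t) = Wt σ (w + k) v (j.1 + t) := by
  have hi := i.2
  have hj := j.2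
  constructor
  · intro h t ht
    have := congrFun h ⟨t, ht⟩
    unfold kmerAt at this
    unfold Wt
    rw [dif_pos (by omega), dif_pos (by omega)]
    exact congrArg _ this
  · intro h
    funext t
    have := h t.1 t.2
    have ht := t.2
    unfold Wt at this
    rw [dif_pos (by omega), dif_pos (by omega)] at this
    exact Fin.ext this

lemma NU_iff (σ k w : ℕ) (v : Fin (w + k) → Fin σ) :
    NU σ k w v ↔ ∃ i, i < w ∧ ∀ t, t < k → Wt σ (w + k) v (i + t) = Wt σ (w + k) v (w + t) := by
  unfold NU
  constructor
  · rintro ⟨i, hi, h⟩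
    refine ⟨i.1, ?_, (kmer_eq_iff σ k w v i _).1 h⟩
    have := i.2
    have : i.1 ≠ w := fun h => hi (Fin.ext h)
    omega
  · rintro ⟨i, hi, h⟩
    refine ⟨⟨i, by omega⟩, ?_, (kmer_eq_iff σ k w v _ _).2 h⟩
    intro h
    have := congrArg Fin.val h
    simp at this
    omega

lemma RP_iff (σ k w : ℕ) (v : Fin (w + k) → Fin σ) :
    RP σ k w v ↔ ∃ i j, i < j ∧ j ≤ w ∧
      ∀ t, t < k → Wt σ (w + k) v (i + t) = Wt σ (w + k) v (j + t) := by
  unfold RP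
  constructor
  · rintro ⟨i, j, hi, h⟩
    have h1 := i.2
    have h2 := j.2
    have : i.1 ≠ j.1 := fun h => hi (Fin.ext h)
    have h3 := (kmer_eq_iff σ k w v i _).1 h
    rcases Nat.lt_or_gt_of_ne this with h4 | h4
    · exact ⟨i.1, j.1, h4, by omega, h3⟩
    · exact ⟨j.1, i.1, h4, by omega, fun t ht => (h3 t ht).symm⟩
  · rintro ⟨i, j, hij, hj, h⟩
    refine ⟨⟨i, by omega⟩, ⟨j, by omega⟩, ?_, (kmer_eq_iff σ k w v _ _).2 h⟩
    intro h
    have := congrArg Fin.val h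
    simp at this
    omega

lemma NU_RP {σ k w : ℕ} {v : Fin (w + k) → Fin σ} (h : NU σ k w v) : RP σ k w v := by
  obtain ⟨i, hi, h⟩ := h
  exact ⟨i, _, hi, h⟩

lemma Wt_ext_lt (σ k w : ℕ) (v : Fin (w + k) → Fin σ) (c : Fin σ) (x : ℕ) (hx : x < w + k) :
    Wt σ (w + 1 + k) (ext1 σ k w v c) x = Wt σ (w + k) v x := by
  unfold Wt ext1
  rw [dif_pos hx, dif_pos (by omega)]
  simp [hx]

lemma Wt_ext_last (σ k w : ℕ) (v : Fin (w + k) → Fin σ) (c : Fin σ) (x : ℕ) (hx : x = w + k) :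
    Wt σ (w + 1 + k) (ext1 σ k w v c) x = c.1 := by
  subst hx
  unfold Wt ext1
  rw [dif_pos (by omega)]
  simp

lemma Wt_pre (σ k w : ℕ) (v : Fin (w + k) → Fin σ) (c : Fin σ) (x : ℕ) :
    Wt σ (w + 1 + k) (pre1 σ k w c v) (x + 1) = Wt σ (w + k) v x := by
  unfold Wt pre1
  by_cases h : x < w + k
  · rw [dif_pos h, dif_pos (by omega)]
    simp
  · rw [dif_neg h, dif_neg (by omega)]

lemma sum_ext (σ k w : ℕ) (h : (Fin (w + 1 + k) → Fin σ) → ℝ) :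
    ∑ v', h v' = ∑ v : Fin (w + k) → Fin σ, ∑ c : Fin σ, h (ext1 σ k w v c) := by
  rw [← Fintype.sum_prod_type']
  symm
  refine Fintype.sum_bijective (fun x : (Fin (w + k) → Fin σ) × Fin σ => ext1 σ k w x.1 x.2)
    ⟨?_, ?_⟩ _ _ (fun _ => rfl)
  · rintro ⟨v, c⟩ ⟨v', c'⟩ he
    simp only at he
    ext1
    · funext x
      have hx := x.2
      have := congrFun he ⟨x.1, by omega⟩
      simpa [ext1] using this
    · have := congrFun he ⟨w + k, by omega⟩
      simpa [ext1] using this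
  · intro v'
    refine ⟨(fun x => v' ⟨x.1, by have := x.2; omega⟩, v' ⟨w + k, by omega⟩), ?_⟩
    funext x
    have hx := x.2
    unfold ext1
    by_cases h : x.1 < w + k
    · simp [h]
    · have : x.1 = w + k := by omega
      simp [← this]

lemma sum_pre (σ k w : ℕ) (h : (Fin (w + 1 + k) → Fin σ) → ℝ) :
    ∑ v', h v' = ∑ v : Fin (w + k) → Fin σ, ∑ c : Fin σ, h (pre1 σ k w c v) := by
  rw [← Fintype.sum_prod_type']
  symm
  refine Fintype.sum_bijective (fun x : (Fin (w + k) → Fin σ) × Fin σ => pre1 σ k w x.2 x.1)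
    ⟨?_, ?_⟩ _ _ (fun _ => rfl)
  · rintro ⟨v, c⟩ ⟨v', c'⟩ he
    simp only at he
    ext1
    · funext x
      have hx := x.2
      have := congrFun he ⟨x.1 + 1, by omega⟩
      simpa [pre1] using this
    · have := congrFun he ⟨0, by omega⟩
      simpa [pre1] using this
  · intro v'
    refine ⟨(fun x => v' ⟨x.1 + 1, by have := x.2; omega⟩, v' ⟨0, by omega⟩), ?_⟩
    funext x
    have hx := x.2
    unfold pre1
    by_cases h : x.1 = 0
    · simp [← h]
    · have : x.1 - 1 + 1 = x.1 := by omega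
      simp [h, this]

/-- extension facts -/
lemma NU_of_ext {σ k w : ℕ} (hwk : w + 1 ≤ k) {v : Fin (w + k) → Fin σ} {c : Fin σ}
    (hr : RP σ k w v) (hn : NU σ k (w + 1) (ext1 σ k w v c)) : NU σ k w v := by
  rw [RP_iff] at hr
  rw [NU_iff] at hn ⊢
  obtain ⟨i, j, hij, hj, hV⟩ := hr
  obtain ⟨s, hs, hU⟩ := hn
  obtain ⟨p, rfl⟩ : ∃ p, j = i + p := ⟨j - i, by omega⟩
  obtain ⟨q, hq⟩ : ∃ q, w + 1 = s + q := ⟨w + 1 - s, by omega⟩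
  set V := Wt σ (w + k) v
  -- period p on [i, i+k+p)
  have P : ∀ x, i ≤ x → x < i + k → V x = V (x + p) := by
    intro x h1 h2
    have := hV (x - i) (by omega)
    rw [show i + (x - i) = x by omega, show i + p + (x - i) = x + p by omega] at this
    exact this
  have Q : ∀ x, s ≤ x → x + q < w + k → V x = V (x + q) := by
    intro x h1 h2
    have := hU (x - s) (by omega)
    rw [show s + (x - s) = x by omega, show w + 1 + (x - s) = x + q by omega,
      Wt_ext_lt _ _ _ _ _ _ (by omega), Wt_ext_lt _ _ _ _ _ _ (by omega)] at this
    exact this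
  by_cases his : i < s
  · refine ⟨s - 1, by omega, fun t ht => ?_⟩
    rcases Nat.eq_zero_or_pos t with rfl | htp
    · have h1 := P (s - 1) (by omega) (by omega)
      have h2 := Q (s - 1 + p) (by omega) (by omega)
      have h3 := P w (by omega) (by omega)
      rw [show s - 1 + p + q = w + p by omega] at h2
      simp only [Nat.add_zero]
      rw [h1, h2, h3]
    · have h2 := Q (s - 1 + t) (by omega) (by omega)
      rw [h2]
      congr 1
      omega
  · refine ⟨w - p, by omega, fun t ht => ?_⟩
    by_cases hx : w - p + t < i + k
    · rw [P _ (by omega) hx]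
      congr 1
      omega
    · have h1 := Q (w - p + t - q) (by omega) (by omega)
      have h2 := P (w - p + t - q) (by omega) (by omega)
      have h3 := Q (w - p + t - q + p) (by omega) (by omega)
      rw [show w - p + t - q + q = w - p + t by omega] at h1
      rw [show w - p + t - q + p + q = w + t by omega] at h3
      rw [← h1, h2, h3]

lemma NU_ext_unique {σ k w : ℕ} (hwk : w + 1 ≤ k) {v : Fin (w + k) → Fin σ}
    (hr : NU σ k w v) : ∃ c₀ : Fin σ, ∀ c, NU σ k (w + 1) (ext1 σ k w v c) ↔ c = c₀ := by
  rw [NU_iff] at hr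
  obtain ⟨i, hi, hV⟩ := hr
  refine ⟨v ⟨i + k, by omega⟩, fun c => ?_⟩
  have hc : Wt σ (w + k) v (i + k) = (v ⟨i + k, by omega⟩).1 := by
    unfold Wt
    rw [dif_pos (by omega)]
  rw [NU_iff, Fin.ext_iff, ← hc]
  set V := Wt σ (w + k) v
  constructor
  · rintro ⟨s, hs, hU⟩
    have h1 := hU (k - 1) (by omega)
    rw [Wt_ext_lt _ _ _ _ _ _ (by omega), Wt_ext_last _ _ _ _ _ _ (by omega)] at h1
    have h2 := hU (i + k - (w + 1)) (by omega)
    rw [Wt_ext_lt _ _ _ _ _ _ (by omega), Wt_ext_lt _ _ _ _ _ _ (by omega)] at h2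
    have h3 := hV (s + k - 1 - w) (by omega)
    rw [← h1]
    show V _ = V _
    change V _ = V _ at h2
    rw [show w + 1 + (i + k - (w + 1)) = i + k by omega] at h2
    rw [show w + (s + k - 1 - w) = s + (k - 1) by omega] at h3
    rw [← h2, ← h3]
    congr 1
    omega
  · intro h
    refine ⟨i + 1, by omega, fun t ht => ?_⟩
    by_cases htk : t + 1 < k
    · rw [Wt_ext_lt _ _ _ _ _ _ (by omega), Wt_ext_lt _ _ _ _ _ _ (by omega)]
      have := hV (t + 1) htk
      rw [show i + 1 + t = i + (t + 1) by omega, show w + 1 + t = w + (t + 1) by omega]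
      exact this
    · rw [Wt_ext_lt _ _ _ _ _ _ (by omega), Wt_ext_last _ _ _ _ _ _ (by omega), h]
      show V _ = V _
      congr 1
      omega

lemma RP_ext_iff {σ k w : ℕ} {v : Fin (w + k) → Fin σ} {c : Fin σ} :
    RP σ k (w + 1) (ext1 σ k w v c) ↔ RP σ k w v ∨ NU σ k (w + 1) (ext1 σ k w v c) := by
  constructor
  · intro h
    by_cases hn : NU σ k (w + 1) (ext1 σ k w v c)
    · exact Or.inr hn
    · left
      rw [NU_iff] at hn
      rw [RP_iff] at h ⊢
      obtain ⟨i, j, hij, hj, hV⟩ := h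
      by_cases hjw : j = w + 1
      · subst hjw
        exact absurd ⟨i, hij, hV⟩ hn
      · refine ⟨i, j, hij, by omega, fun t ht => ?_⟩
        have := hV t ht
        rwa [Wt_ext_lt _ _ _ _ _ _ (by omega), Wt_ext_lt _ _ _ _ _ _ (by omega)] at this
  · rintro (h | h)
    · rw [RP_iff] at h ⊢
      obtain ⟨i, j, hij, hj, hV⟩ := h
      refine ⟨i, j, hij, by omega, fun t ht => ?_⟩
      rw [Wt_ext_lt _ _ _ _ _ _ (by omega), Wt_ext_lt _ _ _ _ _ _ (by omega)]
      exact hV t ht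
    · exact NU_RP h

lemma kmer_ext (σ k w : ℕ) (v : Fin (w + k) → Fin σ) (c : Fin σ) (i : Fin (w + 1)) :
    kmerAt σ k (w + 1) (ext1 σ k w v c) i.castSucc = kmerAt σ k w v i := by
  funext t
  have := i.2
  have := t.2
  unfold kmerAt ext1
  have : i.1 + t.1 < w + k := by omega
  simp [this]

open Classical in
lemma numKmers_ext (σ k w : ℕ) (v : Fin (w + k) → Fin σ) (c : Fin σ) :
    numKmers σ k (w + 1) (ext1 σ k w v c) =
      numKmers σ k w v + if NU σ k (w + 1) (ext1 σ k w v c) then 0 else 1 := by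
  have key : (Finset.univ.image (kmerAt σ k (w + 1) (ext1 σ k w v c))) =
      insert (kmerAt σ k (w + 1) (ext1 σ k w v c) (Fin.last (w + 1)))
        (Finset.univ.image (kmerAt σ k w v)) := by
    ext y
    simp only [Finset.mem_image, Finset.mem_univ, true_and, Finset.mem_insert]
    constructor
    · rintro ⟨i, rfl⟩
      induction i using Fin.lastCases with
      | last => exact Or.inl rfl
      | cast i => exact Or.inr ⟨i, (kmer_ext σ k w v c i).symm⟩
    · rintro (rfl | ⟨i, rfl⟩)
      · exact ⟨_, rfl⟩
      · exact ⟨_, kmer_ext σ k w v c i⟩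
  have hmem : kmerAt σ k (w + 1) (ext1 σ k w v c) (Fin.last (w + 1)) ∈
      (Finset.univ.image (kmerAt σ k w v)) ↔ NU σ k (w + 1) (ext1 σ k w v c) := by
    simp only [Finset.mem_image, Finset.mem_univ, true_and, NU]
    constructor
    · rintro ⟨i, hi⟩
      exact ⟨i.castSucc, (Fin.castSucc_lt_last i).ne, by rw [kmer_ext, hi]⟩
    · rintro ⟨i, hi, h⟩
      induction i using Fin.lastCases with
      | last => exact absurd rfl hi
      | cast i => exact ⟨i, by rw [← h, kmer_ext]⟩
  unfold numKmers
  rw [key]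
  by_cases h : NU σ k (w + 1) (ext1 σ k w v c)
  · rw [if_pos h, Finset.insert_eq_of_mem (hmem.2 h), add_zero]
  · rw [if_neg h, Finset.card_insert_of_notMem (fun hh => h (hmem.1 hh))]

lemma numKmers_of_not_RP {σ k w : ℕ} {v : Fin (w + k) → Fin σ} (h : ¬ RP σ k w v) :
    numKmers σ k w v = w + 1 := by
  unfold numKmers
  rw [Finset.card_image_of_injective]
  · simp
  · intro i j hij
    by_contra hne
    exact h ⟨i, j, hne, hij⟩

open Classical in
noncomputable def FS (σ k w : ℕ) (f : ℕ → ℝ) : ℝ :=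
  ∑ v : Fin (w + k) → Fin σ, if NU σ k w v then f (numKmers σ k w v) else 0

open Classical in
noncomputable def GS (σ k w : ℕ) (f : ℕ → ℝ) : ℝ :=
  ∑ v : Fin (w + k) → Fin σ, if RP σ k w v ∧ ¬ NU σ k w v then f (numKmers σ k w v) else 0

lemma FS_succ (σ k w : ℕ) (hwk : w + 1 ≤ k) :
    ∃ a : ℝ, ∀ f, FS σ k (w + 1) f = FS σ k w f + a * f (w + 1) := by
  classical
  refine ⟨∑ v : Fin (w + k) → Fin σ, if RP σ k w v then 0 else
    ∑ c : Fin σ, if NU σ k (w + 1) (ext1 σ k w v c) then 1 else 0, fun f => ?_⟩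
  unfold FS
  rw [sum_ext, Finset.sum_mul, ← Finset.sum_add_distrib]
  refine Finset.sum_congr rfl fun v _ => ?_
  by_cases hn : NU σ k w v
  · obtain ⟨c₀, hc⟩ := NU_ext_unique hwk hn
    rw [if_pos hn, if_pos (NU_RP hn), Finset.sum_eq_single c₀]
    · rw [if_pos ((hc c₀).2 rfl), numKmers_ext, if_pos ((hc c₀).2 rfl)]
      simp
    · intro c _ hne
      rw [if_neg (fun h => hne ((hc c).1 h))]
    · simp
  · rw [if_neg hn]
    by_cases hr : RP σ k w v
    · rw [if_pos hr]
      simp only [zero_mul, add_zero]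
      refine Finset.sum_eq_zero fun c _ => ?_
      rw [if_neg (fun h => hn (NU_of_ext hwk hr h))]
    · rw [if_neg hr, zero_add, Finset.sum_mul]
      refine Finset.sum_congr rfl fun c _ => ?_
      by_cases h : NU σ k (w + 1) (ext1 σ k w v c)
      · rw [if_pos h, if_pos h, numKmers_ext, if_pos h, numKmers_of_not_RP hr]
        simp
      · simp [h]

lemma GS_succ (σ k w : ℕ) (hwk : w + 1 ≤ k) (f : ℕ → ℝ) :
    GS σ k (w + 1) f = σ * GS σ k w (fun m => f (m + 1)) +
      (σ - 1) * FS σ k w (fun m => f (m + 1)) := by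
  classical
  unfold GS FS
  rw [sum_ext, Finset.mul_sum, Finset.mul_sum, ← Finset.sum_add_distrib]
  refine Finset.sum_congr rfl fun v _ => ?_
  simp only [RP_ext_iff]
  by_cases hn : NU σ k w v
  · obtain ⟨c₀, hc⟩ := NU_ext_unique hwk hn
    have hr := NU_RP hn
    have : ∀ c : Fin σ, (if (RP σ k w v ∨ NU σ k (w + 1) (ext1 σ k w v c)) ∧
        ¬ NU σ k (w + 1) (ext1 σ k w v c) then
        f (numKmers σ k (w + 1) (ext1 σ k w v c)) else 0) =
        f (numKmers σ k w v + 1) - if c = c₀ then f (numKmers σ k w v + 1) else 0 := by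
      intro c
      rw [numKmers_ext]
      by_cases h : c = c₀
      · subst h
        simp [(hc c).2 rfl]
      · have h' : ¬ NU σ k (w + 1) (ext1 σ k w v c) := fun hh => h ((hc c).1 hh)
        simp [h', h, hr]
    rw [Finset.sum_congr rfl fun c _ => this c, Finset.sum_sub_distrib]
    simp [hn]
    ring
  · by_cases hr : RP σ k w v
    · have : ∀ c : Fin σ, ¬ NU σ k (w + 1) (ext1 σ k w v c) :=
        fun c h => hn (NU_of_ext hwk hr h)
      simp [numKmers_ext, this, hr, hn]
    · simp [hr, hn]

lemma FS_zero (σ k : ℕ) (f : ℕ → ℝ) : FS σ k 0 f = 0 := by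
  unfold FS
  refine Finset.sum_eq_zero fun v _ => ?_
  rw [if_neg]
  rw [NU_iff]
  rintro ⟨i, hi, -⟩
  omega

lemma GS_zero (σ k : ℕ) (f : ℕ → ℝ) : GS σ k 0 f = 0 := by
  unfold GS
  refine Finset.sum_eq_zero fun v _ => ?_
  rw [if_neg]
  rw [RP_iff]
  rintro ⟨⟨i, j, hi, hj, -⟩, -⟩
  omega

lemma GS_step (σ k w : ℕ) (hwk : w + 1 ≤ k) :
    ∃ b : ℝ, ∀ f, GS σ k (w + 1) f = GS σ k w f + b * f (w + 1) := by
  induction w with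
  | zero =>
    refine ⟨0, fun f => ?_⟩
    rw [GS_succ _ _ _ hwk, GS_zero, GS_zero, FS_zero]
    simp
  | succ w ih =>
    obtain ⟨b, hb⟩ := ih (by omega)
    obtain ⟨a, ha⟩ := FS_succ σ k w (by omega)
    refine ⟨σ * b + (σ - 1) * a, fun f => ?_⟩
    rw [GS_succ _ _ (w + 1) hwk, hb, ha, GS_succ _ _ w (by omega)]
    ring
open Classical in
lemma min_count {α β : Type*} [Fintype α] [Fintype β] [LinearOrder β]
    (T : Finset α) (x : α) (hx : x ∈ T) :
    (T.card : ℝ) * ((Finset.univ.filter fun ρ : α ≃ β => ∀ y ∈ T, ρ x ≤ ρ y).card : ℝ) =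
      (Fintype.card (α ≃ β) : ℝ) := by
  have h1 : ∀ z ∈ T, (Finset.univ.filter fun ρ : α ≃ β => ∀ y ∈ T, ρ z ≤ ρ y).card =
      (Finset.univ.filter fun ρ : α ≃ β => ∀ y ∈ T, ρ x ≤ ρ y).card := by
    intro z hz
    have hT : ∀ y ∈ T, Equiv.swap z x y ∈ T := by
      intro y hy
      rw [Equiv.swap_apply_def]
      split_ifs <;> assumption
    refine Finset.card_bij' (fun ρ _ => (Equiv.swap z x).trans ρ)
      (fun ρ _ => (Equiv.swap z x).trans ρ) ?_ ?_ ?_ ?_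
    · intro ρ hρ
      simp only [Finset.mem_filter, Finset.mem_univ, true_and, Equiv.trans_apply] at hρ ⊢
      intro y hy
      rw [Equiv.swap_apply_right]
      exact hρ _ (hT y hy)
    · intro ρ hρ
      simp only [Finset.mem_filter, Finset.mem_univ, true_and, Equiv.trans_apply] at hρ ⊢
      intro y hy
      rw [Equiv.swap_apply_left]
      exact hρ _ (hT y hy)
    · intro ρ _
      ext y
      simp
    · intro ρ _
      ext y
      simp
  have h2 : ∑ z ∈ T, (Finset.univ.filter fun ρ : α ≃ β => ∀ y ∈ T, ρ z ≤ ρ y).card =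
      Fintype.card (α ≃ β) := by
    simp only [Finset.card_filter]
    rw [Finset.sum_comm]
    rw [Finset.sum_congr rfl (g := fun _ => 1)]
    · simp
    · intro ρ _
      obtain ⟨m, hm, hmin⟩ := T.exists_min_image ρ ⟨x, hx⟩
      rw [Finset.sum_eq_single m]
      · rw [if_pos hmin]
      · intro z hz hne
        rw [if_neg]
        intro h
        exact hne (ρ.injective (le_antisymm (h m hm) (hmin z hz)))
      · intro h
        exact absurd hm h
  rw [Finset.sum_congr rfl h1] at h2
  rw [← h2]
  simp

open Classical in
lemma Pgc_eq (σ k w : ℕ) (hw : 1 ≤ w) (v : Fin (w + k) → Fin σ) :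
    Pgc σ k w v = (if NU σ k w v then 1 else 2) / (numKmers σ k w v : ℝ) := by
  set T := Finset.univ.image (kmerAt σ k w v) with hTdef
  have hmem : ∀ i, kmerAt σ k w v i ∈ T := fun i => Finset.mem_image_of_mem _ (Finset.mem_univ _)
  have hiff : ∀ (ρ : (Fin k → Fin σ) ≃ Fin (σ ^ k)) x,
      (∀ i, ρ x ≤ ρ (kmerAt σ k w v i)) ↔ ∀ y ∈ T, ρ x ≤ ρ y := by
    intro ρ x
    simp [hTdef]
  have hcard : numKmers σ k w v = T.card := rfl
  have hTpos : (T.card : ℝ) ≠ 0 := by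
    have : 0 < T.card := Finset.card_pos.2 ⟨_, hmem 0⟩
    exact_mod_cast this.ne'
  have h0 : (T.card : ℝ) * ((Finset.univ.filter fun ρ : (Fin k → Fin σ) ≃ Fin (σ ^ k) =>
      ∀ y ∈ T, ρ (kmerAt σ k w v 0) ≤ ρ y).card : ℝ) =
      (Fintype.card ((Fin k → Fin σ) ≃ Fin (σ ^ k)) : ℝ) := by
    convert min_count (β := Fin (σ ^ k)) T _ (hmem 0)
  have hl : (T.card : ℝ) * ((Finset.univ.filter fun ρ : (Fin k → Fin σ) ≃ Fin (σ ^ k) =>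
      ∀ y ∈ T, ρ (kmerAt σ k w v (Fin.last w)) ≤ ρ y).card : ℝ) =
      (Fintype.card ((Fin k → Fin σ) ≃ Fin (σ ^ k)) : ℝ) := by
    convert min_count (β := Fin (σ ^ k)) T _ (hmem (Fin.last w))
  have htot : (Fintype.card ((Fin k → Fin σ) ≃ Fin (σ ^ k)) : ℝ) ≠ 0 := by
    have : Nonempty ((Fin k → Fin σ) ≃ Fin (σ ^ k)) := by
      refine ⟨Fintype.equivFinOfCardEq ?_⟩
      simp
    have : 0 < Fintype.card ((Fin k → Fin σ) ≃ Fin (σ ^ k)) := Fintype.card_pos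
    exact_mod_cast this.ne'
  unfold Pgc
  rw [hcard, Nat.card_eq_fintype_card, Nat.card_eq_fintype_card, Fintype.card_subtype]
  have hU : (∀ i : Fin (w + 1), kmerAt σ k w v i = kmerAt σ k w v (Fin.last w) → i = Fin.last w) ↔
      ¬ NU σ k w v := by
    unfold NU
    push Not
    constructor
    · intro h i hi he
      exact hi (h i he)
    · intro h i he
      by_contra hi
      exact h i hi he
  rw [div_eq_div_iff htot hTpos]
  by_cases hn : NU σ k w v
  · rw [if_pos hn, one_mul, ← h0, mul_comm]
    congr 3
    ext ρ
    simp only [Finset.mem_filter, Finset.mem_univ, true_and, IsGC, hU, hn, hiff]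
    simp
  · rw [if_neg hn]
    have : (Finset.univ.filter fun ρ => IsGC σ k w ρ v) =
        (Finset.univ.filter fun ρ : (Fin k → Fin σ) ≃ Fin (σ ^ k) =>
          ∀ y ∈ T, ρ (kmerAt σ k w v 0) ≤ ρ y) ∪
        (Finset.univ.filter fun ρ : (Fin k → Fin σ) ≃ Fin (σ ^ k) =>
          ∀ y ∈ T, ρ (kmerAt σ k w v (Fin.last w)) ≤ ρ y) := by
      ext ρ
      simp only [Finset.mem_filter, Finset.mem_univ, true_and, IsGC, hU, hn, hiff,
        Finset.mem_union]
      simp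
    rw [this, Finset.card_union_of_disjoint]
    · push_cast
      linarith
    · rw [Finset.disjoint_left]
      intro ρ h1 h2
      simp only [Finset.mem_filter, Finset.mem_univ, true_and] at h1 h2
      have h3 := ρ.injective (le_antisymm (h1 _ (hmem (Fin.last w))) (h2 _ (hmem 0)))
      have h4 := (hU.2 hn) 0 h3
      have h5 := congrArg Fin.val h4
      simp at h5
      omega

lemma per_of {σ N : ℕ} (s : Fin N → Fin σ) (d : ℕ) (hd : 0 < d)
    (h : HasPeriod σ N s d) (y : ℕ) (hy : y < N) :
    s ⟨y, hy⟩ = s ⟨y % d, lt_of_le_of_lt (Nat.mod_le _ _) hy⟩ := by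
  induction y using Nat.strong_induction_on with
  | _ y ih =>
    by_cases hlt : y < d
    · congr 2
      exact (Nat.mod_eq_of_lt hlt).symm
    · have h1 := h (y - d) (by omega)
      have h2 := ih (y - d) (by omega) (by omega)
      have e1 : (⟨y - d + d, by omega⟩ : Fin N) = ⟨y, hy⟩ := Fin.ext (by simp; omega)
      rw [e1] at h1
      rw [← h1, h2]
      congr 2
      exact (Nat.mod_eq_sub_mod (by omega)).symm

lemma prim_iff (σ k N : ℕ) (hN : 0 < N) (hNk : N ≤ k) (s : Fin N → Fin σ) :
    IsPrimitive σ N s ↔ ¬ ∃ i, 1 ≤ i ∧ i < N ∧ ∀ t, t < k →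
      s ⟨(i + t) % N, Nat.mod_lt _ hN⟩ = s ⟨(N + t) % N, Nat.mod_lt _ hN⟩ := by
  unfold IsPrimitive
  rw [not_iff_not]
  obtain ⟨V, hV⟩ : ∃ V : ℕ → Fin σ, ∀ x, V x = s ⟨x % N, Nat.mod_lt _ hN⟩ := ⟨_, fun _ => rfl⟩
  have hVc : ∀ x y, x % N = y % N → V x = V y := by
    intro x y h
    rw [hV, hV]
    congr 2
  simp only [← hV]
  constructor
  · rintro ⟨d, hdN, hlt, hp⟩
    have hd : 0 < d := Nat.pos_of_dvd_of_pos hdN hN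
    refine ⟨N - d, by omega, by omega, fun t _ => ?_⟩
    have key : ∀ x, V x = s ⟨x % d, by have := Nat.mod_lt x hd; omega⟩ := by
      intro x
      rw [hV, per_of s d hd hp]
      congr 2
      exact Nat.mod_mod_of_dvd _ hdN
    rw [key, key]
    congr 2
    rw [show N + t = N - d + t + d by omega]
    simp
  · rintro ⟨i, hi, hiN, h⟩
    have hq : ∀ x, V (x + (N - i)) = V x := by
      intro x
      have h1 := h ((x + (N - i)) % N) (lt_of_lt_of_le (Nat.mod_lt _ hN) hNk)
      have h2 : V (i + (x + (N - i)) % N) = V x := by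
        apply hVc
        rw [Nat.add_mod_mod, show i + (x + (N - i)) = x + N by omega]
        simp
      have h3 : V (N + (x + (N - i)) % N) = V (x + (N - i)) := by
        apply hVc
        simp
      rw [← h3, ← h1, h2]
    have hqm : ∀ m x, V (x + (N - i) * m) = V x := by
      intro m
      induction m with
      | zero => simp
      | succ m ih =>
        intro x
        rw [Nat.mul_succ, ← add_assoc, hq, ih]
    have hg : Nat.gcd (N - i) N ≤ N - i := Nat.gcd_le_left _ (by omega)
    refine ⟨Nat.gcd (N - i) N, Nat.gcd_dvd_right _ _, by omega, ?_⟩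
    intro x hx
    obtain ⟨m, -, hm⟩ := Nat.exists_mul_mod_eq_gcd (n := N - i) (k := N) (by omega)
    have h1 : V (x + Nat.gcd (N - i) N) = V x := by
      rw [← hqm m x]
      apply hVc
      rw [← hm]
      simp
    rw [hV, hV] at h1
    have e1 : (⟨(x + Nat.gcd (N - i) N) % N, Nat.mod_lt _ hN⟩ : Fin N) =
        ⟨x + Nat.gcd (N - i) N, hx⟩ := Fin.ext (Nat.mod_eq_of_lt hx)
    have e2 : (⟨x % N, Nat.mod_lt _ hN⟩ : Fin N) =
        ⟨x, by omega⟩ := Fin.ext (Nat.mod_eq_of_lt (by omega))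
    rw [e1, e2] at h1
    exact h1.symm

/-- gap strictly smaller than maximal -/
def N1 (σ k w : ℕ) (v : Fin (w + 1 + k) → Fin σ) : Prop :=
  ∃ i, 1 ≤ i ∧ i < w + 1 ∧
    ∀ t, t < k → Wt σ (w + 1 + k) v (i + t) = Wt σ (w + 1 + k) v (w + 1 + t)

def N0 (σ k w : ℕ) (v : Fin (w + 1 + k) → Fin σ) : Prop :=
  ∀ t, t < k → Wt σ (w + 1 + k) v t = Wt σ (w + 1 + k) v (w + 1 + t)

lemma NU_split (σ k w : ℕ) (v : Fin (w + 1 + k) → Fin σ) :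
    NU σ k (w + 1) v ↔ N1 σ k w v ∨ N0 σ k w v := by
  rw [NU_iff]
  constructor
  · rintro ⟨i, hi, h⟩
    rcases Nat.eq_zero_or_pos i with rfl | hp
    · right
      intro t ht
      simpa using h t ht
    · left
      exact ⟨i, hp, hi, h⟩
  · rintro (⟨i, _, hi, h⟩ | h)
    · exact ⟨i, hi, h⟩
    · exact ⟨0, by omega, fun t ht => by simpa using h t ht⟩

lemma N1_pre (σ k w : ℕ) (c : Fin σ) (v : Fin (w + k) → Fin σ) :
    N1 σ k w (pre1 σ k w c v) ↔ NU σ k w v := by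
  rw [NU_iff]
  constructor
  · rintro ⟨i, h1, h2, h⟩
    refine ⟨i - 1, by omega, fun t ht => ?_⟩
    have := h t ht
    rw [show i + t = i - 1 + t + 1 by omega, show w + 1 + t = w + t + 1 by omega,
      Wt_pre, Wt_pre] at this
    exact this
  · rintro ⟨i, h1, h⟩
    refine ⟨i + 1, by omega, by omega, fun t ht => ?_⟩
    rw [show i + 1 + t = i + t + 1 by omega, show w + 1 + t = w + t + 1 by omega,
      Wt_pre, Wt_pre]
    exact h t ht

lemma N1_iff_per (σ k w : ℕ) (s : Fin (w + 1) → Fin σ) :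
    N1 σ k w (fun x => s ⟨x.1 % (w + 1), Nat.mod_lt _ (by omega)⟩) ↔
      ∃ i, 1 ≤ i ∧ i < w + 1 ∧ ∀ t, t < k →
      s ⟨(i + t) % (w + 1), Nat.mod_lt _ (by omega)⟩ =
        s ⟨(w + 1 + t) % (w + 1), Nat.mod_lt _ (by omega)⟩ := by
  unfold N1
  refine exists_congr fun i => and_congr_right fun h1 => and_congr_right fun h2 =>
    forall_congr' fun t => imp_congr_right fun ht => ?_
  unfold Wt
  rw [dif_pos (by omega), dif_pos (by omega), Fin.ext_iff]

lemma card_only (σ k w : ℕ) (hwk : w + 1 ≤ k) :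
    Nat.card {v : Fin (w + 1 + k) → Fin σ // N0 σ k w v ∧ ¬ N1 σ k w v} = Prim σ (w + 1) := by
  unfold Prim
  symm
  refine Nat.card_eq_of_bijective (fun s : {s : Fin (w + 1) → Fin σ // IsPrimitive σ (w + 1) s} =>
    (⟨fun x => s.1 ⟨x.1 % (w + 1), Nat.mod_lt _ (by omega)⟩, ?_, ?_⟩ :
      {v : Fin (w + 1 + k) → Fin σ // N0 σ k w v ∧ ¬ N1 σ k w v})) ⟨?_, ?_⟩
  · intro t ht
    unfold Wt
    rw [dif_pos (by omega), dif_pos (by omega)]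
    simp
  · rw [N1_iff_per]
    exact (prim_iff σ k (w + 1) (by omega) hwk s.1).1 s.2
  · rintro ⟨s, hs⟩ ⟨s', hs'⟩ h
    have h := congrArg Subtype.val h
    simp only at h
    ext1
    funext x
    have hx := x.2
    have := congrFun h ⟨x.1, by omega⟩
    simp only at this
    have e : (⟨x.1 % (w + 1), Nat.mod_lt _ (by omega)⟩ : Fin (w + 1)) = x :=
      Fin.ext (Nat.mod_eq_of_lt hx)
    rw [e] at this
    exact this
  · rintro ⟨v, h0, h1⟩
    have hv : (fun x : Fin (w + 1 + k) => (fun y : Fin (w + 1) => v ⟨y.1, by have := y.2; omega⟩)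
        ⟨x.1 % (w + 1), Nat.mod_lt _ (by omega)⟩) = v := by
      funext x
      obtain ⟨x, hx⟩ := x
      symm
      refine per_of v (w + 1) (by omega) ?_ x hx
      intro i hi
      have := h0 i (by omega)
      unfold Wt at this
      rw [dif_pos (by omega), dif_pos (by omega)] at this
      rw [Fin.ext_iff, this]
      congr 3
      omega
    refine ⟨⟨fun y => v ⟨y.1, by have := y.2; omega⟩, ?_⟩, Subtype.ext hv⟩
    rw [prim_iff σ k (w + 1) (by omega) hwk]
    intro hc
    have := (N1_iff_per σ k w (fun y => v ⟨y.1, by have := y.2; omega⟩)).2 hc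
    rw [hv] at this
    exact h1 this

lemma A_succ (σ k w : ℕ) (hwk : w + 1 ≤ k) :
    FS σ k (w + 1) (fun _ => 1) = σ * FS σ k w (fun _ => 1) + Prim σ (w + 1) := by
  classical
  rw [← card_only σ k w hwk, Nat.card_eq_fintype_card, Fintype.card_subtype, Finset.card_filter]
  have h1 : (σ : ℝ) * FS σ k w (fun _ => 1) =
      ∑ v : Fin (w + 1 + k) → Fin σ, if N1 σ k w v then 1 else 0 := by
    rw [sum_pre]
    simp only [N1_pre]
    unfold FS
    rw [Finset.mul_sum]
    simp
  rw [h1]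
  unfold FS
  push_cast
  rw [← Finset.sum_add_distrib]
  refine Finset.sum_congr rfl fun v _ => ?_
  rw [NU_split]
  by_cases a : N1 σ k w v <;> by_cases b : N0 σ k w v <;> simp [a, b]

lemma A_eq (σ k w : ℕ) (hwk : w ≤ k) :
    FS σ k w (fun _ => 1) = ∑ p ∈ Finset.Icc 1 w, (Prim σ p : ℝ) * (σ : ℝ) ^ (w - p) := by
  induction w with
  | zero => simp [FS_zero]
  | succ w ih =>
    rw [A_succ σ k w hwk, ih (by omega), Finset.sum_Icc_succ_top (by omega), Finset.mul_sum]
    congr 1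
    · refine Finset.sum_congr rfl fun p hp => ?_
      have := (Finset.mem_Icc.1 hp).2
      rw [Nat.succ_sub this, pow_succ]
      ring
    · simp

lemma B_eq (σ k w : ℕ) (hwk : w + 1 ≤ k) :
    GS σ k (w + 1) (fun _ => 1) = ∑ p ∈ Finset.Icc 1 w,
      (Prim σ p : ℝ) * (σ : ℝ) ^ (w - p) * (((w : ℝ) - p + 1) * (σ - 1)) := by
  induction w with
  | zero => simp [GS_succ σ k 0 hwk, GS_zero, FS_zero]
  | succ w ih =>
    rw [GS_succ σ k (w + 1) hwk, ih (by omega), A_eq σ k _ (by omega),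
      Finset.sum_Icc_succ_top (by omega), Finset.sum_Icc_succ_top (by omega), mul_add,
      Finset.mul_sum, Finset.mul_sum, ← add_assoc, ← Finset.sum_add_distrib]
    congr 1
    · refine Finset.sum_congr rfl fun p hp => ?_
      have := (Finset.mem_Icc.1 hp).2
      rw [Nat.succ_sub this, pow_succ]
      push_cast
      ring
    · simp
      ring

lemma Dev_eq (σ k w : ℕ) (hw : 1 ≤ w) :
    Dev σ k w = FS σ k w (fun m => 1 / (m : ℝ)) + GS σ k w (fun m => 2 / (m : ℝ)) -
      2 / ((w : ℝ) + 1) * (FS σ k w (fun _ => 1) + GS σ k w (fun _ => 1)) := by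
  classical
  have hR : RepSet σ k w = Finset.univ.filter (fun v => RP σ k w v) := by
    unfold RepSet RP
    congr
  unfold Dev
  rw [hR, Finset.card_filter, Finset.sum_filter]
  unfold FS GS
  push_cast
  rw [← Finset.sum_add_distrib, ← Finset.sum_add_distrib]
  congr 1
  · refine Finset.sum_congr rfl fun v _ => ?_
    rw [Pgc_eq σ k w hw]
    by_cases hn : NU σ k w v
    · simp [hn, NU_RP hn]
    · simp [hn]
  · congr 1
    refine Finset.sum_congr rfl fun v _ => ?_
    by_cases hn : NU σ k w v
    · simp [hn, NU_RP hn]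
    · simp [hn]

theorem stmt13 (σ k w : ℕ) (hσ : 2 ≤ σ) (hw : 1 ≤ w) (hwk : w + 1 ≤ k) :
    ((w : ℝ) + 1) * ((w : ℝ) + 2) * (Dev σ k (w + 1) - Dev σ k w) =
      -(w : ℝ) * (Prim σ (w + 1) : ℝ) +
        ∑ p ∈ Finset.Icc 1 w, (Prim σ p : ℝ) * (σ : ℝ) ^ (w - p) *
          (((w : ℝ) - 2 * p + 2) * σ - w + 2 * p) := by
  obtain ⟨a, ha⟩ := FS_succ σ k w hwk
  obtain ⟨b, hb⟩ := GS_step σ k w hwk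
  have hA := ha (fun _ => 1)
  have hB := hb (fun _ => 1)
  have hB' := B_eq σ k w hwk
  have hA' := A_succ σ k w hwk
  have hAw := A_eq σ k w (by omega)
  have hsum : ∑ p ∈ Finset.Icc 1 w, (Prim σ p : ℝ) * (σ : ℝ) ^ (w - p) *
          (((w : ℝ) - 2 * p + 2) * σ - w + 2 * p) =
      (2 - w * (σ - 1)) * FS σ k w (fun _ => 1) + 2 * GS σ k (w + 1) (fun _ => 1) := by
    rw [hB', hAw, Finset.mul_sum, Finset.mul_sum, ← Finset.sum_add_distrib]
    refine Finset.sum_congr rfl fun p _ => ?_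
    ring
  rw [hsum, Dev_eq σ k (w + 1) (by omega), Dev_eq σ k w hw, ha, hb, hA, hB]
  have hP : (Prim σ (w + 1) : ℝ) = FS σ k w (fun _ => 1) + a - σ * FS σ k w (fun _ => 1) := by
    linarith
  rw [hP]
  have h1 : (w : ℝ) + 1 ≠ 0 := by positivity
  have h2 : (w : ℝ) + 2 ≠ 0 := by positivity
  have h3 : (w : ℝ) + 1 + 1 ≠ 0 := by positivity
  push_cast
  field_simp
  ring
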